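/- arXiv:1409.6108 — 12 statements merged into one kernel-verified Lean document; each statement's English description precedes it below -/
import Mathlib

section
/- For every θ ∈ (0,1) and every n ≥ 1, the all-ones vector e is the unique fixed point of the Dikin map T_θ on Δ_n; that is, for w ∈ Δ_n one has T_θ(w) = w if and only if w_i = 1 for all i. -/
/-- The quadratic map `f_θ(x) = x(1 - θx)`. -/
noncomputable def fmap (θ x : ℝ) : ℝ := x * (1 - θ * x)

/-- The Dikin map `T_θ` on `ℝ^n`, defined coordinatewise by
`T_θ(w)_i = f_θ(w_i) / max_j f_θ(w_j)`. -/
noncomputable def dikin (θ : ℝ) {n : ℕ} (w : Fin n → ℝ) : Fin n → ℝ :=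
  fun i => fmap θ (w i) / ⨆ j, fmap θ (w j)

/-- The projective simplex `Δ_n = {w : 0 < w_i ≤ 1 for all i, max_i w_i = 1}`. -/
def inDelta {n : ℕ} (w : Fin n → ℝ) : Prop :=
  (∀ i, 0 < w i ∧ w i ≤ 1) ∧ ∃ i, w i = 1

/-- For every `θ ∈ (0,1)` and `n ≥ 1`, the all-ones vector is the unique fixed
point of the Dikin map on `Δ_n`. -/
theorem dikin_fixed_point_iff_all_ones (θ : ℝ) (hθ0 : 0 < θ) (hθ1 : θ < 1)
    (n : ℕ) (hn : 1 ≤ n) (w : Fin n → ℝ) (hw : inDelta w) :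
    dikin θ w = w ↔ ∀ i, w i = 1 := by
  obtain ⟨hpos, k, hk⟩ := hw
  constructor
  · intro h i
    have hfix : ∀ j, fmap θ (w j) / (⨆ l, fmap θ (w l)) = w j := fun j => congrFun h j
    have hM : (⨆ l, fmap θ (w l)) ≠ 0 := by
      intro h0
      have := hfix k
      rw [h0, hk, div_zero] at this
      exact zero_ne_one this
    have hf : ∀ j, fmap θ (w j) = w j * ⨆ l, fmap θ (w l) := fun j =>
      (div_eq_iff hM).mp (hfix j)
    have hsup := hf k
    have hi := hf i
    rw [hk, one_mul] at hsup
    rw [← hsup] at hi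
    have hcancel : 1 - θ * w i = fmap θ 1 := mul_left_cancel₀ (hpos i).1.ne' hi
    have hθ : θ * w i = θ * 1 := by
      unfold fmap at hcancel
      linarith
    exact mul_left_cancel₀ hθ0.ne' hθ
  · intro h
    have : Nonempty (Fin n) := ⟨k⟩
    have hne : fmap θ 1 ≠ 0 := by
      simpa [fmap, sub_eq_zero] using hθ1.ne'
    ext i
    simp only [dikin, h, ciSup_const, div_self hne]
end

section
/- For every θ ∈ (0, 1/2] and every w ∈ Δ_n, each coordinate does not decrease under the Dikin map: T_θ(w)_i ≥ w_i for all i. -/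
theorem fmap_le_one_sub {θ x : ℝ} (hθ0 : 0 < θ) (hθ1 : θ ≤ 1 / 2) (hx : x ≤ 1) :
    fmap θ x ≤ 1 - θ := by
  unfold fmap
  have hfactor : 0 ≤ 1 - θ * (1 + x) := by nlinarith
  nlinarith [mul_nonneg (sub_nonneg.2 hx) hfactor]

/-- For `θ ∈ (0, 1/2]` and `w ∈ Δ_n`, every coordinate does not decrease
under the Dikin map. -/
theorem dikin_coord_nondecreasing (θ : ℝ) (hθ0 : 0 < θ) (hθ1 : θ ≤ 1 / 2)
    (n : ℕ) (hn : 1 ≤ n) (w : Fin n → ℝ) (hw : inDelta w) :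
    ∀ i, w i ≤ dikin θ w i := by
  obtain ⟨hbd, k, hk⟩ := hw
  intro i
  have hsup_le : ⨆ j, fmap θ (w j) ≤ 1 - θ :=
    haveI : Nonempty (Fin n) := ⟨k⟩
    ciSup_le fun j => fmap_le_one_sub hθ0 hθ1 (hbd j).2
  have hle_sup : 1 - θ ≤ ⨆ j, fmap θ (w j) := by
    simpa [fmap, hk] using
      le_ciSup (f := fun j => fmap θ (w j)) (Set.finite_range _).bddAbove k
  have hpos : 0 < 1 - θ := by linarith
  rw [dikin, le_antisymm hsup_le hle_sup, le_div_iff₀ hpos, fmap]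
  obtain ⟨hi0, hi1⟩ := hbd i
  exact mul_le_mul_of_nonneg_left (by nlinarith) hi0.le
end

section
/- For every θ ∈ (0, 1/2] and every initial point w ∈ Δ_n, the iterates T_θ^k(w) converge, as k → ∞, to the all-ones vector e. -/
theorem fmap_le_fmap_one {θ x : ℝ} (hθ0 : 0 < θ) (hθ1 : θ ≤ 1 / 2) (hx : x ≤ 1) :
    fmap θ x ≤ fmap θ 1 := by
  have h : 0 ≤ (1 - x) * (1 - θ * (1 + x)) :=
    mul_nonneg (by linarith) (by nlinarith)
  unfold fmap
  linarith

/-- On `Δ_n` with `θ ≤ 1/2` the normalising maximum is attained at the coordinate equal to `1`. -/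
theorem dikin_apply {θ : ℝ} (hθ0 : 0 < θ) (hθ1 : θ ≤ 1 / 2) {n : ℕ} {w : Fin n → ℝ}
    (hw : inDelta w) (i : Fin n) : dikin θ w i = fmap θ (w i) / (1 - θ) := by
  obtain ⟨i₀, hi₀⟩ := hw.2
  have : Nonempty (Fin n) := ⟨i₀⟩
  have hsup : ⨆ j, fmap θ (w j) = 1 - θ := by
    have h1 : fmap θ 1 = 1 - θ := by simp [fmap]
    have hle : ∀ j, fmap θ (w j) ≤ 1 - θ :=
      fun j => h1 ▸ fmap_le_fmap_one hθ0 hθ1 (hw.1 j).2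
    refine le_antisymm (ciSup_le hle) ?_
    rw [← h1, ← hi₀]
    exact le_ciSup (f := fun j => fmap θ (w j)) (Set.finite_range _).bddAbove i₀
  simp only [dikin, hsup]

theorem one_sub_fmap_div {θ : ℝ} (hθ : θ ≠ 1) (x : ℝ) :
    1 - fmap θ x / (1 - θ) = (1 - x) * (1 - θ * x / (1 - θ)) := by
  have : 1 - θ ≠ 0 := sub_ne_zero.2 hθ.symm
  unfold fmap
  field_simp
  ring

theorem one_sub_fmap_div_le {θ x : ℝ} (hθ0 : 0 < θ) (hθ1 : θ ≤ 1 / 2) (hx0 : 0 < x)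
    (hx1 : x ≤ 1) : 1 - fmap θ x / (1 - θ) ≤ (1 - x) * (1 - θ * x) := by
  rw [one_sub_fmap_div (by linarith)]
  have : θ * x ≤ θ * x / (1 - θ) := le_div_self (by positivity) (by linarith) (by linarith)
  exact mul_le_mul_of_nonneg_left (by linarith) (by linarith)

theorem le_fmap_div {θ x : ℝ} (hθ0 : 0 < θ) (hθ1 : θ ≤ 1 / 2) (hx0 : 0 < x)
    (hx1 : x ≤ 1) : x ≤ fmap θ x / (1 - θ) := by
  have := one_sub_fmap_div_le hθ0 hθ1 hx0 hx1
  nlinarith [mul_nonneg (sub_nonneg.2 hx1) (mul_pos hθ0 hx0).le]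

theorem inDelta.dikin {θ : ℝ} (hθ0 : 0 < θ) (hθ1 : θ ≤ 1 / 2) {n : ℕ} {w : Fin n → ℝ}
    (hw : inDelta w) : inDelta (dikin θ w) := by
  have hpos : 0 < 1 - θ := by linarith
  refine ⟨fun i => ?_, ?_⟩
  · rw [dikin_apply hθ0 hθ1 hw]
    refine ⟨(hw.1 i).1.trans_le (le_fmap_div hθ0 hθ1 (hw.1 i).1 (hw.1 i).2), ?_⟩
    rw [div_le_one hpos]
    simpa [fmap] using fmap_le_fmap_one hθ0 hθ1 (hw.1 i).2
  · obtain ⟨i, hi⟩ := hw.2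
    refine ⟨i, ?_⟩
    rw [dikin_apply hθ0 hθ1 hw, hi]
    simp [fmap, hpos.ne']

theorem inDelta.iterate_dikin {θ : ℝ} (hθ0 : 0 < θ) (hθ1 : θ ≤ 1 / 2) {n : ℕ}
    {w : Fin n → ℝ} (hw : inDelta w) (k : ℕ) : inDelta ((_root_.dikin θ)^[k] w) := by
  induction k with
  | zero => exact hw
  | succ k ih =>
    rw [Function.iterate_succ_apply']
    exact ih.dikin hθ0 hθ1

theorem le_iterate_dikin {θ : ℝ} (hθ0 : 0 < θ) (hθ1 : θ ≤ 1 / 2) {n : ℕ}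
    {w : Fin n → ℝ} (hw : inDelta w) (k : ℕ) (i : Fin n) : w i ≤ (dikin θ)^[k] w i := by
  induction k with
  | zero => exact le_rfl
  | succ k ih =>
    have hk := hw.iterate_dikin hθ0 hθ1 k
    rw [Function.iterate_succ_apply', dikin_apply hθ0 hθ1 hk]
    exact ih.trans (le_fmap_div hθ0 hθ1 (hk.1 i).1 (hk.1 i).2)

/-- The iterates approach `1` geometrically in each coordinate. -/
theorem one_sub_iterate_dikin_le {θ : ℝ} (hθ0 : 0 < θ) (hθ1 : θ ≤ 1 / 2) {n : ℕ}
    {w : Fin n → ℝ} (hw : inDelta w) (k : ℕ) (i : Fin n) :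
    1 - (dikin θ)^[k] w i ≤ (1 - θ * w i) ^ k := by
  induction k with
  | zero => simpa using (hw.1 i).1.le
  | succ k ih =>
    have hk := hw.iterate_dikin hθ0 hθ1 k
    have hwi := hw.1 i
    have hr : 0 ≤ 1 - θ * w i := by nlinarith
    rw [Function.iterate_succ_apply', dikin_apply hθ0 hθ1 hk, pow_succ]
    refine (one_sub_fmap_div_le hθ0 hθ1 (hk.1 i).1 (hk.1 i).2).trans ?_
    have hmono : 1 - θ * (dikin θ)^[k] w i ≤ 1 - θ * w i :=
      sub_le_sub_left (mul_le_mul_of_nonneg_left (le_iterate_dikin hθ0 hθ1 hw k i) hθ0.le) 1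
    exact (mul_le_mul_of_nonneg_left hmono (sub_nonneg.2 (hk.1 i).2)).trans
      (mul_le_mul_of_nonneg_right ih hr)

open Filter Topology in
/-- For `θ ∈ (0, 1/2]` and every initial point `w ∈ Δ_n`, the Dikin iterates
converge to the all-ones vector. -/
theorem dikin_tendsto_ones_of_le_half (θ : ℝ) (hθ0 : 0 < θ) (hθ1 : θ ≤ 1 / 2)
    (n : ℕ) (hn : 1 ≤ n) (w : Fin n → ℝ) (hw : inDelta w) :
    Tendsto (fun k => (dikin θ)^[k] w) atTop (𝓝 (fun _ => 1)) := by
  refine tendsto_pi_nhds.2 fun i => ?_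
  have hwi := hw.1 i
  have hpow : Tendsto (fun k : ℕ => (1 - θ * w i) ^ k) atTop (𝓝 0) :=
    tendsto_pow_atTop_nhds_zero_of_lt_one (by nlinarith) (by nlinarith)
  have hlow : Tendsto (fun k : ℕ => 1 - (1 - θ * w i) ^ k) atTop (𝓝 1) := by
    simpa using hpow.const_sub 1
  refine tendsto_of_tendsto_of_tendsto_of_le_of_le hlow tendsto_const_nhds (fun k => ?_)
    fun k => ((hw.iterate_dikin hθ0 hθ1 k).1 i).2
  have := one_sub_iterate_dikin_le hθ0 hθ1 hw k i
  dsimp only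
  linarith
end

section
/- For every θ ∈ (1/2, 2/3] and every initial point w ∈ Δ_n, the iterates T_θ^k(w) converge, as k → ∞, to the all-ones vector e. -/
lemma min_fmap_le_fmap {θ l u a : ℝ} (hθ : 0 ≤ θ) (hl : l ≤ a) (hu : a ≤ u) :
    min (fmap θ l) (fmap θ u) ≤ fmap θ a := by
  unfold fmap
  rcases le_total (θ * (u + a)) 1 with h | h
  · have h' : θ * (l + a) ≤ 1 := by nlinarith
    exact min_le_of_left_le (by nlinarith [mul_nonneg (sub_nonneg.2 hl) (sub_nonneg.2 h')])
  · exact min_le_of_right_le (by nlinarith [mul_nonneg (sub_nonneg.2 hu) (sub_nonneg.2 h)])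

/-- A map on `(0, 1]` whose iterates bound the smallest coordinate of Dikin iterates from below. -/
noncomputable def lowerMap (m : ℝ) : ℝ := m + m * (1 - m) ^ 2 / 6

lemma le_lowerMap {m : ℝ} (h0 : 0 ≤ m) : m ≤ lowerMap m := by
  unfold lowerMap
  have : 0 ≤ m * (1 - m) ^ 2 / 6 := by positivity
  linarith

lemma lowerMap_le_one {m : ℝ} (h0 : 0 ≤ m) (h1 : m ≤ 1) : lowerMap m ≤ 1 := by
  unfold lowerMap
  have h : 0 ≤ 6 - m * (1 - m) := by nlinarith
  nlinarith [mul_nonneg (sub_nonneg.2 h1) h]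

lemma lowerMap_mul_fmap_le {θ m a b : ℝ} (hθ0 : 1 / 2 ≤ θ) (hθ1 : θ ≤ 2 / 3) (hm : 0 ≤ m)
    (ha : m ≤ a) (ha1 : a ≤ 1) (hb : m ≤ b) (hb1 : b ≤ 1) :
    lowerMap m * fmap θ b ≤ fmap θ a := by
  refine le_trans ?_ (min_fmap_le_fmap (by linarith) ha ha1)
  have hb0 : 0 ≤ b := hm.trans hb
  have hm1 : m ≤ 1 := ha.trans ha1
  have hfb : fmap θ b ≤ 1 := by
    unfold fmap
    nlinarith [mul_nonneg (by linarith : (0 : ℝ) ≤ θ) (sq_nonneg b)]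
  have hc : 0 ≤ m * (1 - m) ^ 2 / 6 := by positivity
  have hsplit : lowerMap m * fmap θ b ≤ m * fmap θ b + m * (1 - m) ^ 2 / 6 := by
    unfold lowerMap
    nlinarith [mul_nonneg hc (sub_nonneg.2 hfb)]
  refine hsplit.trans (le_min ?_ ?_)
  · have key : (1 - m) ^ 2 / 6 ≤ (1 - b) * (1 - θ * b) + θ * (b - m) := by
      have h1 : 1 / 3 ≤ 1 - θ * b := by nlinarith
      nlinarith [mul_nonneg (sub_nonneg.2 hb1) (sub_nonneg.2 h1),
        mul_nonneg (sub_nonneg.2 hb) (sub_nonneg.2 hθ0), mul_nonneg hm (sub_nonneg.2 hm1)]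
    unfold fmap
    nlinarith [mul_le_mul_of_nonneg_left key hm]
  · have hmb : 0 ≤ 1 - m * b ^ 2 := by nlinarith [mul_nonneg hm hb0, pow_le_one₀ hb0 hb1 (n := 2)]
    have hθ : (1 - 3 * m * b + 2 * m * b ^ 2) / 3 ≤ fmap θ 1 - m * fmap θ b := by
      unfold fmap
      nlinarith [mul_nonneg (sub_nonneg.2 hθ1) hmb]
    have h1 : (1 - b) ^ 2 + m * (b - m) ^ 2 ≤ 1 - 3 * m * b + 2 * m * b ^ 2 := by
      have e : 1 - 3 * m * b + 2 * m * b ^ 2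
          = (1 - b) ^ 2 * (1 + 2 * b) + (b - m) * (b * (3 - 2 * b)) := by ring
      have e1 : (1 - b) ^ 2 ≤ (1 - b) ^ 2 * (1 + 2 * b) := by nlinarith [sq_nonneg (1 - b)]
      have e2 : m * (b - m) ≤ b * (3 - 2 * b) :=
        mul_le_mul hb (by linarith) (by linarith) hb0
      nlinarith [mul_le_mul_of_nonneg_left e2 (sub_nonneg.2 hb)]
    have h2 : m * (1 - m) ^ 2 / 2 ≤ (1 - b) ^ 2 + m * (b - m) ^ 2 := by
      have e : (1 - m) ^ 2 / 2 ≤ (1 - b) ^ 2 + (b - m) ^ 2 := by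
        nlinarith [sq_nonneg ((1 - b) - (b - m))]
      nlinarith [mul_le_mul_of_nonneg_left e hm,
        mul_nonneg (sub_nonneg.2 hm1) (sq_nonneg (1 - b))]
    linarith

lemma fmap_pos {θ x : ℝ} (hθ0 : 0 ≤ θ) (hθ1 : θ < 1) (hx0 : 0 < x) (hx1 : x ≤ 1) :
    0 < fmap θ x :=
  mul_pos hx0 (by nlinarith)

lemma exists_dikin_eq_div {θ : ℝ} {n : ℕ} {w : Fin n → ℝ} (hw : inDelta w) :
    ∃ i, (∀ j, fmap θ (w j) ≤ fmap θ (w i)) ∧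
      ∀ j, dikin θ w j = fmap θ (w j) / fmap θ (w i) := by
  obtain ⟨i₀, -⟩ := hw.2
  have : Nonempty (Fin n) := ⟨i₀⟩
  obtain ⟨i, hi⟩ := exists_eq_ciSup_of_finite (f := fun j => fmap θ (w j))
  refine ⟨i, fun j => ?_, fun j => ?_⟩
  · rw [hi]
    exact le_ciSup (f := fun j => fmap θ (w j)) (Set.finite_range _).bddAbove j
  · rw [hi, dikin]

lemma inDelta_dikin {θ : ℝ} (hθ0 : 0 ≤ θ) (hθ1 : θ < 1) {n : ℕ} {w : Fin n → ℝ}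
    (hw : inDelta w) : inDelta (dikin θ w) := by
  obtain ⟨i, hi, hT⟩ := exists_dikin_eq_div (θ := θ) hw
  have hpos j := fmap_pos hθ0 hθ1 (hw.1 j).1 (hw.1 j).2
  refine ⟨fun j => ?_, i, by rw [hT, div_self (hpos i).ne']⟩
  rw [hT]
  exact ⟨div_pos (hpos j) (hpos i), div_le_one_of_le₀ (hi j) (hpos i).le⟩

lemma lowerMap_le_dikin {θ m : ℝ} (hθ0 : 1 / 2 ≤ θ) (hθ1 : θ ≤ 2 / 3) (hm : 0 ≤ m) {n : ℕ}
    {w : Fin n → ℝ} (hw : inDelta w) (hmw : ∀ i, m ≤ w i) (j : Fin n) :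
    lowerMap m ≤ dikin θ w j := by
  obtain ⟨i, -, hT⟩ := exists_dikin_eq_div (θ := θ) hw
  have hpos := fmap_pos (by linarith) (by linarith : θ < 1) (hw.1 i).1 (hw.1 i).2
  rw [hT, le_div_iff₀ hpos]
  exact lowerMap_mul_fmap_le hθ0 hθ1 hm (hmw j) (hw.1 j).2 (hmw i) (hw.1 i).2

lemma iterate_lowerMap_mem {m : ℝ} (h0 : 0 < m) (h1 : m ≤ 1) (k : ℕ) :
    m ≤ lowerMap^[k] m ∧ lowerMap^[k] m ≤ 1 := by
  induction k with
  | zero => simpa using h1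
  | succ k ih =>
    rw [Function.iterate_succ_apply']
    have h := h0.le.trans ih.1
    exact ⟨ih.1.trans (le_lowerMap h), lowerMap_le_one h ih.2⟩

open Filter Topology in
lemma tendsto_iterate_lowerMap {m : ℝ} (h0 : 0 < m) (h1 : m ≤ 1) :
    Tendsto (fun k => lowerMap^[k] m) atTop (𝓝 1) := by
  have hmem := iterate_lowerMap_mem h0 h1
  have hmono : Monotone fun k => lowerMap^[k] m := monotone_nat_of_le_succ fun k => by
    rw [Function.iterate_succ_apply']
    exact le_lowerMap (h0.le.trans (hmem k).1)
  have hlim := tendsto_atTop_ciSup hmono ⟨1, by rintro _ ⟨k, rfl⟩; exact (hmem k).2⟩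
  set L := ⨆ k, lowerMap^[k] m
  have hL : m ≤ L := ge_of_tendsto' hlim fun k => (hmem k).1
  have hcont : Continuous lowerMap := by unfold lowerMap; fun_prop
  have hfix : lowerMap L = L := isFixedPt_of_tendsto_iterate hlim hcont.continuousAt
  have hprod : L * (1 - L) ^ 2 = 0 := by unfold lowerMap at hfix; linarith
  have hL1 : 1 - L = 0 := by simpa [(h0.trans_le hL).ne'] using hprod
  rwa [← sub_eq_zero.1 hL1] at hlim

lemma inDelta.exists_lower_bound {n : ℕ} {w : Fin n → ℝ} (hw : inDelta w) :
    ∃ m, 0 < m ∧ m ≤ 1 ∧ ∀ i, m ≤ w i := by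
  obtain ⟨i₀, -⟩ := hw.2
  have : Nonempty (Fin n) := ⟨i₀⟩
  obtain ⟨i, hi⟩ := Finite.exists_min w
  exact ⟨w i, (hw.1 i).1, (hw.1 i).2, hi⟩

open Filter Topology in
/-- For `θ ∈ (1/2, 2/3]` and every initial point `w ∈ Δ_n`, the Dikin iterates
converge to the all-ones vector. -/
theorem dikin_tendsto_ones_of_le_two_thirds (θ : ℝ) (hθ0 : 1 / 2 < θ) (hθ1 : θ ≤ 2 / 3)
    (n : ℕ) (hn : 1 ≤ n) (w : Fin n → ℝ) (hw : inDelta w) :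
    Tendsto (fun k => (dikin θ)^[k] w) atTop (𝓝 (fun _ => 1)) := by
  obtain ⟨m, h0, h1, hm⟩ := hw.exists_lower_bound
  have hk : ∀ k, inDelta ((dikin θ)^[k] w) ∧ ∀ i, lowerMap^[k] m ≤ (dikin θ)^[k] w i := by
    intro k
    induction k with
    | zero => exact ⟨hw, hm⟩
    | succ k ih =>
      simp only [Function.iterate_succ_apply']
      exact ⟨inDelta_dikin (by linarith) (by linarith) ih.1,
        lowerMap_le_dikin hθ0.le hθ1 (h0.le.trans (iterate_lowerMap_mem h0 h1 k).1) ih.1 ih.2⟩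
  exact tendsto_pi_nhds.2 fun i => tendsto_of_tendsto_of_tendsto_of_le_of_le
    (tendsto_iterate_lowerMap h0 h1) tendsto_const_nhds (fun k => (hk k).2 i)
    fun k => ((hk k).1.1 i).2
end

section
/- Let θ ∈ (2/3, 1), let r = (1−θ+√((1−θ)²+4θ(1−θ)))/(2θ), let g_θ(x) = x(1−θx)/(r(1−θr)) and s = (r+θ−1)/(rθ). Then the derivative of g_θ at s equals (2−r−2θ)/(1−θ), r > 3(1−θ), and consequently g_θ'(s) < −1, so the fixed point s of g_θ is repelling. -/
/-- The number `(a + √(a² + 4ta)) / (2t)` is a root of `t x² - a x - a`. -/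
theorem quadratic_root_eq {t a r : ℝ} (ht : 0 < t) (ha : 0 < a)
    (hr : r = (a + Real.sqrt (a ^ 2 + 4 * t * a)) / (2 * t)) :
    t * r ^ 2 = a * (1 + r) := by
  have hsq := Real.sq_sqrt (show 0 ≤ a ^ 2 + 4 * t * a by positivity)
  rw [hr]
  generalize Real.sqrt (a ^ 2 + 4 * t * a) = w at hsq
  field_simp
  linear_combination hsq

/-- A positive root of `θ x² = (1 - θ)(1 + x)` exceeds `3 (1 - θ)` when `θ ∈ (2/3, 1)`. -/
theorem three_mul_one_sub_lt_root {θ r : ℝ} (hθ0 : 2 / 3 < θ) (hθ1 : θ < 1) (hr0 : 0 < r)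
    (hq : θ * r ^ 2 = (1 - θ) * (1 + r)) : 3 * (1 - θ) < r := by
  by_contra! h
  have ha : 0 < 1 - θ := by linarith
  have hpos : 0 < θ * r - (1 - θ) :=
    pos_of_mul_pos_right (b := θ * r - (1 - θ)) (a := r) (by nlinarith) hr0.le
  have hmono : r * (θ * r - (1 - θ)) ≤ 3 * (1 - θ) * (θ * (3 * (1 - θ)) - (1 - θ)) := by
    gcongr
  have hneg : 0 < (1 - θ) * (3 * θ - 2) ^ 2 := by
    have : 0 < 3 * θ - 2 := by linarith
    positivity
  nlinarith

/-- The derivative of a scaled logistic map. -/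
theorem deriv_mul_one_sub_mul_div (θ c x : ℝ) :
    deriv (fun x => x * (1 - θ * x) / c) x = (1 - 2 * θ * x) / c := by
  have h := ((hasDerivAt_id' x).mul (((hasDerivAt_id' x).const_mul θ).const_sub 1)).div_const c
  refine h.deriv.trans ?_
  ring


/-- For `θ ∈ (2/3, 1)`, `r = (1-θ+√((1-θ)²+4θ(1-θ)))/(2θ)`,
`g_θ(x) = x(1-θx)/(r(1-θr))` and `s = (r+θ-1)/(rθ)`: the derivative of `g_θ`
at `s` equals `(2-r-2θ)/(1-θ)`, `r > 3(1-θ)`, and hence `g_θ'(s) < -1`,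
so the fixed point `s` is repelling. -/
theorem g_deriv_at_s_repelling (θ : ℝ) (hθ0 : 2 / 3 < θ) (hθ1 : θ < 1)
    (r : ℝ) (hr : r = (1 - θ + Real.sqrt ((1 - θ) ^ 2 + 4 * θ * (1 - θ))) / (2 * θ))
    (s : ℝ) (hs : s = (r + θ - 1) / (r * θ)) :
    deriv (fun x => x * (1 - θ * x) / (r * (1 - θ * r))) s = (2 - r - 2 * θ) / (1 - θ) ∧
    3 * (1 - θ) < r ∧
    deriv (fun x => x * (1 - θ * x) / (r * (1 - θ * r))) s < -1 := by
  have hθ : 0 < θ := by linarith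
  have ha : 0 < 1 - θ := by linarith
  have hr0 : 0 < r := by rw [hr]; positivity
  have hq := quadratic_root_eq hθ ha hr
  have hlt := three_mul_one_sub_lt_root hθ0 hθ1 hr0 hq
  have hden : r ^ 2 * (1 - θ * r) = 1 - θ := by linear_combination (1 - r) * hq
  have hderiv : deriv (fun x => x * (1 - θ * x) / (r * (1 - θ * r))) s =
      (2 - r - 2 * θ) / (1 - θ) := by
    have hnum : 1 - 2 * θ * s = (2 - r - 2 * θ) / r := by
      rw [hs]
      field_simp
      ring
    rw [deriv_mul_one_sub_mul_div, hnum, div_div, ← hden]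
    congr 1
    ring
  refine ⟨hderiv, hlt, ?_⟩
  rw [hderiv, div_lt_iff₀ ha]
  linarith
end

section
/- Let θ ∈ (2/3, (1+√5)/4], let r = (1−θ+√((1−θ)²+4θ(1−θ)))/(2θ), let g_θ(x) = x(1−θx)/(r(1−θr)) and s = (r+θ−1)/(rθ). Then g_θ²(x) < x for all x ∈ (r, s) and g_θ²(x) > x for all x ∈ (s, 1), where g_θ² denotes the second iterate of g_θ. -/
/-- If `θ(r² + r + 1) = 1 + r`, then `{r, 1}` is a 2-cycle of `x ↦ x(1-θx)/(r(1-θr))`,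
which makes the second iterate minus the identity factor completely. -/
theorem second_iterate_sub_self_eq {θ r : ℝ} (hr : 0 < r)
    (hθ : θ * (r ^ 2 + r + 1) = 1 + r) {g : ℝ → ℝ}
    (hg : ∀ x, g x = x * (1 - θ * x) / (r * (1 - θ * r))) (x : ℝ) :
    g (g x) - x =
      (1 + r) ^ 2 / r ^ 3 * (x * (x - r) * (1 - x) * ((1 + r) * x - (1 + r ^ 2))) := by
  have hD : r ^ 2 + r + 1 ≠ 0 := by positivity
  have hg' : ∀ x, g x = x * (r ^ 2 + r + 1 - (1 + r) * x) / r := by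
    intro x
    have hθ' : θ = (1 + r) / (r ^ 2 + r + 1) := by
      rw [eq_div_iff hD, hθ]
    have hden : 1 - θ * r = 1 / (r ^ 2 + r + 1) := by
      rw [hθ']
      field_simp
      ring
    rw [hg, hden, hθ']
    field_simp
  rw [hg' (g x), hg' x]
  field_simp
  ring

/-- For `θ ∈ (2/3, (1+√5)/4]`, `r = (1-θ+√((1-θ)²+4θ(1-θ)))/(2θ)`,
`g_θ(x) = x(1-θx)/(r(1-θr))` and `s = (r+θ-1)/(rθ)`: the second iterate of
`g_θ` satisfies `g_θ²(x) < x` on `(r, s)` and `g_θ²(x) > x` on `(s, 1)`. -/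
theorem g_second_iterate_ineq (θ : ℝ) (hθ0 : 2 / 3 < θ) (hθ1 : θ ≤ (1 + Real.sqrt 5) / 4)
    (r : ℝ) (hr : r = (1 - θ + Real.sqrt ((1 - θ) ^ 2 + 4 * θ * (1 - θ))) / (2 * θ))
    (g : ℝ → ℝ) (hg : ∀ x, g x = x * (1 - θ * x) / (r * (1 - θ * r)))
    (s : ℝ) (hs : s = (r + θ - 1) / (r * θ)) :
    (∀ x ∈ Set.Ioo r s, g (g x) < x) ∧
    (∀ x ∈ Set.Ioo s 1, x < g (g x)) := by
  have hθpos : 0 < θ := by linarith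
  have hθlt : θ < 1 := by
    have : Real.sqrt 5 < 3 := by
      rw [Real.sqrt_lt' (by norm_num)]
      norm_num
    linarith
  have hdisc : 0 ≤ (1 - θ) ^ 2 + 4 * θ * (1 - θ) := by
    have := mul_pos hθpos (sub_pos.2 hθlt)
    nlinarith [sq_nonneg (1 - θ)]
  have hrpos : 0 < r := by
    rw [hr]
    have := Real.sqrt_nonneg ((1 - θ) ^ 2 + 4 * θ * (1 - θ))
    exact div_pos (by linarith) (by linarith)
  have hθr : θ * (r ^ 2 + r + 1) = 1 + r := by
    have hsqrt : 2 * θ * r - (1 - θ) = Real.sqrt ((1 - θ) ^ 2 + 4 * θ * (1 - θ)) := by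
      rw [hr]
      field_simp
      ring
    have hsq := Real.sq_sqrt hdisc
    rw [← hsqrt] at hsq
    refine mul_left_cancel₀ (mul_pos four_pos hθpos).ne' ?_
    linear_combination hsq
  have hrlt : r < 1 := by
    by_contra! h
    nlinarith [mul_lt_mul_of_pos_right hθ0 (show 0 < r ^ 2 + r + 1 by positivity)]
  have hs' : (1 + r) * s = 1 + r ^ 2 := by
    rw [hs]
    field_simp
    linear_combination (1 - r) * hθr
  have hrs : r < s := by nlinarith
  have hslt : s < 1 := by nlinarith
  have hfactor := second_iterate_sub_self_eq hrpos hθr hg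
  have hcoef : 0 < (1 + r) ^ 2 / r ^ 3 := by positivity
  have hmid : ∀ x, r < x → x < 1 → 0 < x * (x - r) * (1 - x) := fun x h₁ h₂ =>
    mul_pos (mul_pos (hrpos.trans h₁) (sub_pos.2 h₁)) (sub_pos.2 h₂)
  constructor
  · rintro x ⟨hrx, hxs⟩
    have hlin : (1 + r) * x - (1 + r ^ 2) < 0 := by nlinarith
    rw [← sub_neg, hfactor]
    exact mul_neg_of_pos_of_neg hcoef
      (mul_neg_of_pos_of_neg (hmid x hrx (hxs.trans hslt)) hlin)
  · rintro x ⟨hsx, hx⟩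
    have hlin : 0 < (1 + r) * x - (1 + r ^ 2) := by nlinarith
    rw [← sub_pos, hfactor]
    exact mul_pos hcoef (mul_pos (hmid x (hrs.trans hsx) hx) hlin)
end

section
/- Let θ ∈ (2/3, (1+√5)/4], let r = (1−θ+√((1−θ)²+4θ(1−θ)))/(2θ), let g_θ(x) = x(1−θx)/(r(1−θr)) and s = (r+θ−1)/(rθ). Then for every x ∈ (r, s) the even iterates g_θ^{2k}(x) converge to r as k → ∞, and for every x ∈ (s, 1) the even iterates g_θ^{2k}(x) converge to 1; hence every orbit of g_θ starting in (r,1)\{s} converges to the period-two cycle {r, 1}. -/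
open Filter Topology

/-- If `h` is continuous and pushes every point of `(a, b)` strictly down without leaving
the interval, then its iterates on `(a, b)` converge to `a`. -/
theorem tendsto_iterate_of_lt_self {h : ℝ → ℝ} {a b x : ℝ} (hc : Continuous h)
    (hh : ∀ y ∈ Set.Ioo a b, a < h y ∧ h y < y) (hx : x ∈ Set.Ioo a b) :
    Tendsto (fun k => h^[k] x) atTop (𝓝 a) := by
  have mem : ∀ k, h^[k] x ∈ Set.Ioo a b := by
    intro k
    induction k with
    | zero => exact hx
    | succ k ih =>
      rw [Function.iterate_succ_apply']
      exact ⟨(hh _ ih).1, (hh _ ih).2.trans ih.2⟩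
  have anti : Antitone (fun k => h^[k] x) := by
    refine antitone_nat_of_succ_le fun k => ?_
    rw [Function.iterate_succ_apply']
    exact (hh _ (mem k)).2.le
  have bdd : BddBelow (Set.range fun k => h^[k] x) :=
    ⟨a, by rintro _ ⟨k, rfl⟩; exact (mem k).1.le⟩
  have lim := tendsto_atTop_ciInf anti bdd
  have fixed := isFixedPt_of_tendsto_iterate lim hc.continuousAt
  have ge : a ≤ ⨅ k, h^[k] x := le_ciInf fun k => (mem k).1.le
  have lt : (⨅ k, h^[k] x) < b := (ciInf_le bdd 0).trans_lt hx.2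
  rcases ge.eq_or_lt with heq | hlt
  · rwa [← heq] at lim
  · exact absurd fixed (hh _ ⟨hlt, lt⟩).2.ne

/-- If `h` is continuous and pushes every point of `(a, b)` strictly up without leaving
the interval, then its iterates on `(a, b)` converge to `b`. -/
theorem tendsto_iterate_of_self_lt {h : ℝ → ℝ} {a b x : ℝ} (hc : Continuous h)
    (hh : ∀ y ∈ Set.Ioo a b, y < h y ∧ h y < b) (hx : x ∈ Set.Ioo a b) :
    Tendsto (fun k => h^[k] x) atTop (𝓝 b) := by
  have conj : ∀ k, (fun y => -h (-y))^[k] (-x) = -h^[k] x := fun k =>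
    (Function.Semiconj.iterate_right (f := fun y : ℝ => -y) (ga := h) (gb := fun y => -h (-y))
      (fun y => by simp) k x).symm
  have lim := tendsto_iterate_of_lt_self (h := fun y => -h (-y)) (a := -b) (b := -a) (x := -x)
    (by fun_prop)
    (fun y hy => by
      have := hh (-y) ⟨by linarith [hy.2], by linarith [hy.1]⟩
      constructor <;> linarith [this.1, this.2])
    ⟨neg_lt_neg hx.2, neg_lt_neg hx.1⟩
  simpa [conj] using lim.neg

/-- The defining quadratic of `r` determines `θ` as a rational function of `r`; the two bounds on
`θ` say that `r < 1` and that `r` lies to the right of the critical point. -/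
theorem root_properties {θ r : ℝ} (hθ0 : 2 / 3 < θ) (hθ1 : θ ≤ (1 + Real.sqrt 5) / 4)
    (hr : r = (1 - θ + Real.sqrt ((1 - θ) ^ 2 + 4 * θ * (1 - θ))) / (2 * θ)) :
    θ = (r + 1) / (r ^ 2 + r + 1) ∧ 0 < r ∧ r < 1 ∧ 1 ≤ r ^ 2 + r := by
  have h5 : Real.sqrt 5 ^ 2 = 5 := Real.sq_sqrt (by norm_num)
  have h5' : Real.sqrt 5 < 3 := by
    rw [Real.sqrt_lt' (by norm_num)]; norm_num
  have hθlt : θ < 1 := by linarith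
  have hdisc : 0 < (1 - θ) ^ 2 + 4 * θ * (1 - θ) := by
    have : 0 < θ * (1 - θ) := mul_pos (by linarith) (by linarith)
    nlinarith [sq_nonneg (1 - θ)]
  have hsq := Real.sq_sqrt hdisc.le
  have hpos := Real.sqrt_pos.2 hdisc
  generalize Real.sqrt ((1 - θ) ^ 2 + 4 * θ * (1 - θ)) = d at hr hsq hpos
  have hr0 : 0 < r := by
    rw [hr]; exact div_pos (by linarith) (by linarith)
  have hd : d = 2 * θ * r - (1 - θ) := by
    rw [hr]; field_simp; ring
  have hquad : θ * (r ^ 2 + r + 1) = r + 1 := by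
    have : θ * (θ * (r ^ 2 + r + 1)) = θ * (r + 1) := by
      rw [hd] at hsq; linarith
    exact mul_left_cancel₀ (by linarith) this
  have hq : 0 < r ^ 2 + r + 1 := by positivity
  refine ⟨(eq_div_iff hq.ne').2 hquad, hr0, ?_, ?_⟩
  · have : 2 / 3 * (r ^ 2 + r + 1) < r + 1 := by
      rw [← hquad]; exact mul_lt_mul_of_pos_right hθ0 hq
    nlinarith
  · have hcrit : 4 * θ ^ 2 - 2 * θ - 1 ≤ 0 := by
      nlinarith [Real.sqrt_nonneg 5]
    have hmul : (4 * θ ^ 2 - 2 * θ - 1) * (r ^ 2 + r + 1) ^ 2 =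
        -((r ^ 2 + r - 1) * (r ^ 2 + 3 * r + 1)) := by
      linear_combination (4 * (θ * (r ^ 2 + r + 1)) + 4 * (r + 1) - 2 * (r ^ 2 + r + 1)) * hquad
    have hle : 0 ≤ (r ^ 2 + r - 1) * (r ^ 2 + 3 * r + 1) := by
      have := mul_nonpos_of_nonpos_of_nonneg hcrit (sq_nonneg (r ^ 2 + r + 1))
      linarith
    have := nonneg_of_mul_nonneg_left hle (by positivity)
    linarith

/-- For `θ ∈ (2/3, (1+√5)/4]`, `r = (1-θ+√((1-θ)²+4θ(1-θ)))/(2θ)`,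
`g_θ(x) = x(1-θx)/(r(1-θr))` and `s = (r+θ-1)/(rθ)`: for `x ∈ (r, s)` the even
iterates `g_θ^{2k}(x)` converge to `r`, and for `x ∈ (s, 1)` they converge
to `1`; hence every orbit starting in `(r,1) \ {s}` converges to the
period-two cycle `{r, 1}`. -/
theorem g_even_iterates_converge (θ : ℝ) (hθ0 : 2 / 3 < θ) (hθ1 : θ ≤ (1 + Real.sqrt 5) / 4)
    (r : ℝ) (hr : r = (1 - θ + Real.sqrt ((1 - θ) ^ 2 + 4 * θ * (1 - θ))) / (2 * θ))
    (g : ℝ → ℝ) (hg : ∀ x, g x = x * (1 - θ * x) / (r * (1 - θ * r)))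
    (s : ℝ) (hs : s = (r + θ - 1) / (r * θ)) :
    (∀ x ∈ Set.Ioo r s, Tendsto (fun k => g^[2 * k] x) atTop (𝓝 r)) ∧
    (∀ x ∈ Set.Ioo s 1, Tendsto (fun k => g^[2 * k] x) atTop (𝓝 1)) := by
  obtain ⟨hθ, hr0, hr1, hcrit⟩ := root_properties hθ0 hθ1 hr
  clear hr
  have hq : 0 < r ^ 2 + r + 1 := by positivity
  have hden : r * (1 - θ * r) = r / (r ^ 2 + r + 1) := by
    rw [hθ]; field_simp; ring
  have hg' : ∀ x, g x = x * (r ^ 2 + r + 1 - (r + 1) * x) / r := by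
    intro x
    rw [hg, hden, hθ]; field_simp
  have hs' : s = (r ^ 2 + 1) / (r + 1) := by
    rw [hs, hθ]; field_simp; ring
  have hrs : r < s := by
    rw [hs', lt_div_iff₀ (by linarith)]; nlinarith
  have hs1 : s < 1 := by
    rw [hs', div_lt_one (by linarith)]; nlinarith
  have hcont : Continuous g := by
    rw [funext hg']; fun_prop
  have hmap : ∀ x ∈ Set.Ioo r 1, g x ∈ Set.Ioo r 1 := by
    rintro x ⟨hx0, hx1⟩
    rw [hg', Set.mem_Ioo, lt_div_iff₀ hr0, div_lt_one hr0]
    have h1 : 0 < (1 - x) * ((r + 1) * x - r ^ 2) :=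
      mul_pos (by linarith) (by nlinarith)
    have h2 : 0 < (x - r) * ((r + 1) * x - 1) :=
      mul_pos (by linarith) (by nlinarith)
    constructor <;> nlinarith
  have hfactor : ∀ x, g (g x) - x =
      ((r + 1) ^ 3 / r ^ 3) * (x * (x - r) * (1 - x)) * (x - s) := by
    intro x
    rw [hg' (g x), hg' x, hs']; field_simp; ring
  have hcoef : ∀ x ∈ Set.Ioo r 1, 0 < ((r + 1) ^ 3 / r ^ 3) * (x * (x - r) * (1 - x)) := by
    rintro x ⟨hx0, hx1⟩
    have := sub_pos.2 hx0
    have := sub_pos.2 hx1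
    have := hr0.trans hx0
    positivity
  simp only [Function.iterate_mul]
  constructor <;> intro x hx
  · refine tendsto_iterate_of_lt_self (hcont.iterate 2) (fun y hy => ?_) hx
    have hy' : y ∈ Set.Ioo r 1 := ⟨hy.1, hy.2.trans hs1⟩
    refine ⟨(hmap _ (hmap _ hy')).1, sub_neg.1 ?_⟩
    exact (hfactor y).trans_lt (mul_neg_of_pos_of_neg (hcoef y hy') (sub_neg.2 hy.2))
  · refine tendsto_iterate_of_self_lt (hcont.iterate 2) (fun y hy => ?_) hx
    have hy' : y ∈ Set.Ioo r 1 := ⟨hrs.trans hy.1, hy.2⟩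
    refine ⟨sub_pos.1 ?_, (hmap _ (hmap _ hy')).2⟩
    exact (mul_pos (hcoef y hy') (sub_pos.2 hy.1)).trans_eq (hfactor y).symm
end

section
/- Let θ ∈ (1/2, 1), let Q_θ(x) = 4θx(1−x) be the logistic map, and suppose the critical point c = 1/2 is periodic under Q_θ with period m, i.e. Q_θ^m(1/2) = 1/2. Define w ∈ ℝ^m by w_i = Q_θ^i(1/2)/θ for i = 1, …, m. Then w ∈ Δ_m (in particular max_i w_i = Q_θ(1/2)/θ = 1), the Dikin map T_θ sends w to the cyclic permutation of its coordinates (T_θ(w)_i = w_{(i mod m)+1}), and consequently T_θ^m(w) = w, so w is a periodic point of T_θ of period m. -/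
/-- The logistic map `Q_θ(x) = 4θx(1 - x)`. -/
noncomputable def logistic (θ x : ℝ) : ℝ := 4 * θ * x * (1 - x)

/-- The window of length `n` of the critical orbit of `Q_θ`, rescaled by `1/θ`, that starts
at time `k + 1`. -/
noncomputable def orbitWindow (θ : ℝ) (n k : ℕ) : Fin n → ℝ :=
  fun i => (logistic θ)^[i.val + 1 + k] (1 / 2) / θ

lemma logistic_half (θ : ℝ) : logistic θ (1 / 2) = θ := by
  unfold logistic; ring

lemma logistic_le {θ : ℝ} (hθ : 0 ≤ θ) (x : ℝ) : logistic θ x ≤ θ := by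
  unfold logistic; nlinarith [mul_nonneg hθ (sq_nonneg (2 * x - 1))]

lemma logistic_iterate_half_mem_Ioo {θ : ℝ} (h0 : 0 < θ) (h1 : θ < 1) (k : ℕ) :
    (logistic θ)^[k] (1 / 2) ∈ Set.Ioo (0 : ℝ) 1 := by
  induction k with
  | zero => norm_num
  | succ k ih =>
    rw [Function.iterate_succ_apply']
    refine ⟨?_, (logistic_le h0.le _).trans_lt h1⟩
    have hpos := sub_pos.2 ih.2
    have hpos' := ih.1
    unfold logistic at hpos hpos' ⊢
    positivity

lemma fmap_div {θ : ℝ} (hθ : θ ≠ 0) (y : ℝ) :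
    fmap θ (y / θ) = logistic θ y / θ / (4 * θ) := by
  unfold fmap logistic
  field_simp

/-- Along a periodic critical orbit, a full window always contains the critical point. -/
lemma exists_iterate_half_eq {θ : ℝ} {m : ℕ} (hm : 1 ≤ m)
    (hQ : Function.IsPeriodicPt (logistic θ) m (1 / 2)) (k : ℕ) :
    ∃ i : Fin m, (logistic θ)^[i.val + 1 + k] (1 / 2) = 1 / 2 := by
  have hk := Nat.mod_lt k hm
  refine ⟨⟨m - 1 - k % m, by omega⟩, ?_⟩
  have h : m - 1 - k % m + 1 + k = m * (k / m + 1) := by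
    have := Nat.div_add_mod k m
    rw [Nat.mul_add]
    omega
  rw [h]
  exact hQ.mul_const _

lemma iSup_fmap_orbitWindow {θ : ℝ} (hθ : 0 < θ) {m : ℕ} (hm : 1 ≤ m)
    (hQ : Function.IsPeriodicPt (logistic θ) m (1 / 2)) (k : ℕ) :
    ⨆ j, fmap θ (orbitWindow θ m k j) = 1 / (4 * θ) := by
  have : Nonempty (Fin m) := ⟨⟨0, hm⟩⟩
  obtain ⟨i, hi⟩ := exists_iterate_half_eq hm hQ k
  have hle (j : Fin m) : fmap θ (orbitWindow θ m k j) ≤ 1 / (4 * θ) := by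
    rw [orbitWindow, fmap_div hθ.ne']
    gcongr
    exact (div_le_one hθ).2 (logistic_le hθ.le _)
  refine le_antisymm (ciSup_le hle) (le_ciSup_of_le ⟨_, Set.forall_mem_range.2 hle⟩ i ?_)
  rw [orbitWindow, hi, fmap_div hθ.ne', logistic_half, div_self hθ.ne']

/-- The Dikin map shifts a window of a periodic critical orbit by one step. -/
lemma dikin_orbitWindow {θ : ℝ} (hθ : 0 < θ) {m : ℕ} (hm : 1 ≤ m)
    (hQ : Function.IsPeriodicPt (logistic θ) m (1 / 2)) (k : ℕ) :
    dikin θ (orbitWindow θ m k) = orbitWindow θ m (k + 1) := by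
  funext i
  rw [dikin, iSup_fmap_orbitWindow hθ hm hQ, orbitWindow, fmap_div hθ.ne', orbitWindow,
    ← add_assoc, Function.iterate_succ_apply']
  field_simp

lemma dikin_iterate_orbitWindow {θ : ℝ} (hθ : 0 < θ) {m : ℕ} (hm : 1 ≤ m)
    (hQ : Function.IsPeriodicPt (logistic θ) m (1 / 2)) (k : ℕ) :
    (dikin θ)^[k] (orbitWindow θ m 0) = orbitWindow θ m k := by
  induction k with
  | zero => rfl
  | succ k ih => rw [Function.iterate_succ_apply', ih, dikin_orbitWindow hθ hm hQ]

/-- If the critical point `1/2` of the logistic map `Q_θ(x) = 4θx(1-x)` is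
periodic with period `m`, then the vector `w ∈ Δ_m` with `w_i = Q_θ^i(1/2)/θ`
(for `i = 1, …, m`) is mapped by the Dikin map to the cyclic permutation of its
coordinates, and is a periodic point of the Dikin map of period `m`. -/
theorem dikin_periodic_from_logistic (θ : ℝ) (hθ0 : 1 / 2 < θ) (hθ1 : θ < 1)
    (m : ℕ) (hm : 1 ≤ m)
    (hQ : (fun x : ℝ => 4 * θ * x * (1 - x))^[m] (1 / 2) = 1 / 2)
    (w : Fin m → ℝ)
    (hw : ∀ i : Fin m, w i = (fun x : ℝ => 4 * θ * x * (1 - x))^[i.val + 1] (1 / 2) / θ) :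
    inDelta w ∧
    (∀ i : Fin m, dikin θ w i = w ⟨(i.val + 1) % m, Nat.mod_lt _ hm⟩) ∧
    (dikin θ)^[m] w = w := by
  have h0 : 0 < θ := by linarith
  have hper : Function.IsPeriodicPt (logistic θ) m (1 / 2) := hQ
  obtain rfl : w = orbitWindow θ m 0 := funext hw
  refine ⟨⟨fun i => ⟨?_, ?_⟩, ⟨0, hm⟩, ?_⟩, fun i => ?_, ?_⟩
  · exact div_pos (logistic_iterate_half_mem_Ioo h0 hθ1 _).1 h0
  · rw [orbitWindow, add_zero, Function.iterate_succ_apply', div_le_one h0]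
    exact logistic_le h0.le _
  · exact (congrArg (· / θ) (logistic_half θ)).trans (div_self h0.ne')
  · rw [dikin_orbitWindow h0 hm hper, orbitWindow, orbitWindow, ← hper.iterate_mod_apply,
      ← hper.iterate_mod_apply ((i.val + 1) % m + 1 + 0)]
    simp
  · rw [dikin_iterate_orbitWindow h0 hm hper]
    funext i
    rw [orbitWindow, orbitWindow, Function.iterate_add_apply, hper.eq, add_zero]
end

section
/- Let θ ∈ (1/2, 1), let Q_θ(x) = 4θx(1−x), suppose Q_θ^m(1/2) = 1/2, and let w ∈ Δ_m be the periodic point of the Dikin map T_θ with coordinates w_i = Q_θ^i(1/2)/θ. Then this periodic orbit is locally stable: there exists ε > 0 such that for every v ∈ Δ_m with ‖v − w‖ < ε, the iterates T_θ^{mk}(v) converge to w as k → ∞. -/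
theorem fmap_le {θ : ℝ} (hθ : 0 < θ) (x : ℝ) : fmap θ x ≤ 1 / (4 * θ) := by
  rw [fmap, le_div_iff₀ (by positivity)]
  nlinarith [sq_nonneg (2 * θ * x - 1)]

theorem fmap_eq {θ : ℝ} (hθ : 0 < θ) (x : ℝ) :
    fmap θ x = 1 / (4 * θ) - θ * (x - 1 / (2 * θ)) ^ 2 := by
  rw [fmap]
  field_simp
  ring

theorem hasDerivAt_fmap (θ x : ℝ) : HasDerivAt (fmap θ) (1 - 2 * θ * x) x := by
  have h := (hasDerivAt_id x).mul (((hasDerivAt_id x).const_mul θ).const_sub 1)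
  refine h.congr_deriv ?_
  simp only [id]
  ring

theorem fmap_le_iSup (θ : ℝ) {n : ℕ} (v : Fin n → ℝ) (c : Fin n) :
    fmap θ (v c) ≤ ⨆ j, fmap θ (v j) :=
  le_ciSup (f := fun j => fmap θ (v j)) (Set.finite_range _).bddAbove c

theorem iSup_fmap_le {θ : ℝ} (hθ : 0 < θ) {n : ℕ} (v : Fin n → ℝ) :
    ⨆ j, fmap θ (v j) ≤ 1 / (4 * θ) :=
  Real.iSup_le (fun j => fmap_le hθ (v j)) (by positivity)

theorem iSup_fmap_of_critical {θ : ℝ} (hθ : 0 < θ) {n : ℕ} {u : Fin n → ℝ} {c : Fin n}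
    (hc : u c = 1 / (2 * θ)) : ⨆ j, fmap θ (u j) = 1 / (4 * θ) := by
  refine le_antisymm (iSup_fmap_le hθ u) ?_
  have h := fmap_le_iSup θ u c
  rwa [fmap_eq hθ, hc, sub_self, zero_pow two_ne_zero, mul_zero, sub_zero] at h

/-- The normalising factor of the Dikin map is flat at a point with a critical coordinate. -/
theorem hasFDerivAt_iSup_fmap {θ : ℝ} (hθ : 0 < θ) {n : ℕ} {u : Fin n → ℝ} {c : Fin n}
    (hc : u c = 1 / (2 * θ)) :
    HasFDerivAt (fun v : Fin n → ℝ => ⨆ j, fmap θ (v j)) (0 : (Fin n → ℝ) →L[ℝ] ℝ) u := by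
  have hO : (fun v : Fin n → ℝ => (⨆ j, fmap θ (v j)) - ⨆ j, fmap θ (u j))
      =O[nhds u] fun v => ‖v - u‖ ^ 2 := by
    refine Asymptotics.IsBigO.of_bound θ (Filter.Eventually.of_forall fun v => ?_)
    have h₁ := fmap_le_iSup θ v c
    have h₂ := iSup_fmap_le hθ v
    have h₃ : (v c - u c) ^ 2 ≤ ‖v - u‖ ^ 2 := by
      rw [← sq_abs]
      exact pow_le_pow_left₀ (abs_nonneg _) (norm_le_pi_norm (v - u) c) 2
    rw [fmap_eq hθ, ← hc] at h₁
    rw [iSup_fmap_of_critical hθ hc, norm_pow, norm_norm, Real.norm_eq_abs, abs_le]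
    have h₄ := mul_le_mul_of_nonneg_left h₃ hθ.le
    have h₅ : 0 ≤ θ * ‖v - u‖ ^ 2 := by positivity
    constructor <;> linarith
  simpa only [sub_add_cancel] using
    (hO.hasFDerivAt (𝕜 := ℝ) one_lt_two).add_const (⨆ j, fmap θ (u j))

theorem dikin_apply_of_critical {θ : ℝ} (hθ : 0 < θ) {n : ℕ} {u : Fin n → ℝ} {c : Fin n}
    (hc : u c = 1 / (2 * θ)) (i : Fin n) : dikin θ u i = 4 * θ * fmap θ (u i) := by
  rw [dikin, iSup_fmap_of_critical hθ hc, one_div, div_inv_eq_mul, mul_comm]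

theorem hasFDerivAt_dikin_of_critical {θ : ℝ} (hθ : 0 < θ) {n : ℕ} {u : Fin n → ℝ} {c : Fin n}
    (hc : u c = 1 / (2 * θ)) :
    HasFDerivAt (dikin θ) (ContinuousLinearMap.pi fun i =>
      (4 * θ * (1 - 2 * θ * u i)) • ContinuousLinearMap.proj (R := ℝ) (φ := fun _ => ℝ) i) u := by
  rw [hasFDerivAt_pi]
  intro i
  have hnum : HasFDerivAt (fun v : Fin n → ℝ => fmap θ (v i))
      ((1 - 2 * θ * u i) • ContinuousLinearMap.proj (R := ℝ) (φ := fun _ => ℝ) i) u :=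
    HasDerivAt.comp_hasFDerivAt (f := fun v : Fin n → ℝ => v i) u (hasDerivAt_fmap θ (u i))
      (hasFDerivAt_apply i u)
  have hS := iSup_fmap_of_critical hθ hc
  have hS0 : (⨆ j, fmap θ (u j)) ≠ 0 := by rw [hS]; positivity
  have hdiv := hnum.mul ((hasDerivAt_inv hS0).comp_hasFDerivAt u (hasFDerivAt_iSup_fmap hθ hc))
  refine hdiv.congr_fderiv ?_
  rw [smul_zero, smul_zero, zero_add, smul_smul]
  congr 1
  simp only [Function.comp_apply]
  rw [hS, one_div, inv_inv]

open Filter Topology in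
/-- A fixed point with vanishing derivative is attracting. -/
theorem exists_tendsto_iterate_of_hasFDerivAt_zero {E : Type*} [NormedAddCommGroup E]
    [NormedSpace ℝ E] {g : E → E} {w : E} (hg : HasFDerivAt g (0 : E →L[ℝ] E) w)
    (hw : g w = w) :
    ∃ ε > (0 : ℝ), ∀ v, ‖v - w‖ < ε → Tendsto (fun k => g^[k] v) atTop (𝓝 w) := by
  have hlo := hg.isLittleO.def (c := 1 / 2) (by norm_num)
  obtain ⟨ε, hε, hball⟩ := Metric.eventually_nhds_iff.1 hlo
  refine ⟨ε, hε, fun v hv => ?_⟩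
  have hstep : ∀ x, ‖x - w‖ < ε → ‖g x - w‖ ≤ 1 / 2 * ‖x - w‖ := fun x hx => by
    simpa [hw] using hball (y := x) (by rwa [dist_eq_norm])
  have hiter : ∀ k, ‖g^[k] v - w‖ ≤ (1 / 2) ^ k * ‖v - w‖ := by
    intro k
    induction k with
    | zero => simp
    | succ k ih =>
      have hle : (1 / 2 : ℝ) ^ k * ‖v - w‖ ≤ ‖v - w‖ :=
        mul_le_of_le_one_left (norm_nonneg _) (pow_le_one₀ (by norm_num) (by norm_num))
      rw [Function.iterate_succ_apply', pow_succ]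
      have := hstep _ (lt_of_le_of_lt (ih.trans hle) hv)
      linarith
  rw [tendsto_iff_norm_sub_tendsto_zero]
  refine squeeze_zero (fun _ => norm_nonneg _) hiter ?_
  simpa using (tendsto_pow_atTop_nhds_zero_of_lt_one (r := (1 / 2 : ℝ))
    (by norm_num) (by norm_num)).mul_const ‖v - w‖

/-- The iterates of the Dikin map along a periodic critical orbit of the logistic map shift the
orbit, and their derivatives are diagonal. -/
theorem dikin_iterate_of_periodic {θ : ℝ} (hθ : 0 < θ) {m : ℕ} (hm : 1 ≤ m) {o : ℕ → ℝ}
    (hstep : ∀ n, o (n + 1) = 4 * θ * fmap θ (o n)) (hcrit : ∀ q, o (m * q) = 1 / (2 * θ))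
    (w : Fin m → ℝ) (hw : ∀ i : Fin m, w i = o (i.val + 1)) (k : ℕ) :
    (∀ i : Fin m, (dikin θ)^[k] w i = o (i.val + 1 + k)) ∧
    HasFDerivAt (dikin θ)^[k] (ContinuousLinearMap.pi fun i : Fin m =>
      (∏ j ∈ Finset.range k, (4 * θ * (1 - 2 * θ * o (i.val + 1 + j)))) •
        ContinuousLinearMap.proj (R := ℝ) (φ := fun _ => ℝ) i) w := by
  induction k with
  | zero =>
    refine ⟨fun i => by simp [hw], (hasFDerivAt_id w).congr_fderiv ?_⟩
    ext x i
    simp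
  | succ k ih =>
    obtain ⟨hval, hder⟩ := ih
    have hlt := Nat.mod_lt k hm
    have hc : (dikin θ)^[k] w ⟨m - 1 - k % m, by omega⟩ = 1 / (2 * θ) := by
      rw [hval, ← hcrit (k / m + 1)]
      congr 1
      have := Nat.div_add_mod k m
      rw [Nat.mul_add, mul_one]
      simp only
      omega
    constructor
    · intro i
      rw [Function.iterate_succ_apply', dikin_apply_of_critical hθ hc, hval, ← hstep, add_assoc]
    · rw [Function.iterate_succ']
      refine ((hasFDerivAt_dikin_of_critical hθ hc).comp w hder).congr_fderiv ?_
      ext x i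
      simp only [ContinuousLinearMap.comp_apply, ContinuousLinearMap.pi_apply,
        _root_.smul_apply, ContinuousLinearMap.proj_apply, smul_eq_mul, hval,
        Finset.prod_range_succ]
      ring

open Filter Topology in
/-- The periodic point of the Dikin map obtained from a periodic critical orbit
of the logistic map `Q_θ(x) = 4θx(1-x)` is locally stable: nearby points of
`Δ_m` converge to it under the iterates `T_θ^{mk}`. -/
theorem dikin_periodic_point_locally_stable (θ : ℝ) (hθ0 : 1 / 2 < θ) (hθ1 : θ < 1)
    (m : ℕ) (hm : 1 ≤ m)
    (hQ : (fun x : ℝ => 4 * θ * x * (1 - x))^[m] (1 / 2) = 1 / 2)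
    (w : Fin m → ℝ)
    (hw : ∀ i : Fin m, w i = (fun x : ℝ => 4 * θ * x * (1 - x))^[i.val + 1] (1 / 2) / θ) :
    ∃ ε > (0 : ℝ), ∀ v : Fin m → ℝ, inDelta v → ‖v - w‖ < ε →
      Tendsto (fun k => (dikin θ)^[m * k] v) atTop (𝓝 w) := by
  have hθ : 0 < θ := by linarith
  set Q : ℝ → ℝ := fun x => 4 * θ * x * (1 - x) with hQdef
  set o : ℕ → ℝ := fun n => Q^[n] (1 / 2) / θ with ho
  have hstep : ∀ n, o (n + 1) = 4 * θ * fmap θ (o n) := fun n => by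
    simp only [ho, Function.iterate_succ_apply', fmap, hQdef]
    field_simp
  have hcrit : ∀ q, o (m * q) = 1 / (2 * θ) := fun q => by
    have h : Q^[m * q] (1 / 2) = 1 / 2 := Function.IsPeriodicPt.mul_const (f := Q) hQ q
    simp only [ho, h]
    field_simp
  obtain ⟨hval, hder⟩ := dikin_iterate_of_periodic hθ hm hstep hcrit w hw m
  have hfix : (dikin θ)^[m] w = w := by
    ext i
    rw [hval, hw]
    change Q^[i.val + 1 + m] (1 / 2) / θ = Q^[i.val + 1] (1 / 2) / θ
    rw [Function.iterate_add_apply, hQ]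
  have hzero : HasFDerivAt (dikin θ)^[m] (0 : (Fin m → ℝ) →L[ℝ] (Fin m → ℝ)) w := by
    refine hder.congr_fderiv ?_
    ext x i
    have hprod : ∏ j ∈ Finset.range m, (4 * θ * (1 - 2 * θ * o (i.val + 1 + j))) = 0 := by
      refine Finset.prod_eq_zero (Finset.mem_range.2 (show m - 1 - i.val < m by omega)) ?_
      rw [show i.val + 1 + (m - 1 - i.val) = m * 1 by omega, hcrit]
      field_simp
      ring
    rw [ContinuousLinearMap.pi_apply, hprod, zero_smul]
    rfl
  obtain ⟨ε, hε, h⟩ := exists_tendsto_iterate_of_hasFDerivAt_zero hzero hfix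
  refine ⟨ε, hε, fun v _ hv => ?_⟩
  simpa only [Function.iterate_mul] using h v hv
end

section
/- Let m ≥ 1 and let A be the m×m real matrix whose only nonzero entries are the subdiagonal entries A_{i+1,i} = d_i for i = 1, …, m−1 and the last-column entries A_{i,m} = −c_i for i = 1, …, m, where d_1 > d_2 > … > d_{m−1} > 0 and 0 < c_1 < c_2 < … < c_m < 1. If c_i d_i < c_{i+1} for all i ≤ m−1, then the characteristic polynomial det(λI − A) = Σ_{k=0}^m a_k λ^k has strictly decreasing positive coefficients: 1 = a_m > a_{m−1} > … > a_0 > 0, and a_0 = c_1 d_1 d_2 ⋯ d_{m−1}. -/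
/-- The square matrix of size `n + 1` with subdiagonal `d 1, …, d n`, last column
`-c 1, …, -c (n + 1)`, and zeros elsewhere. -/
def subdiagonalLastColumn {R : Type*} [CommRing R] (n : ℕ) (c d : ℕ → R) :
    Matrix (Fin (n + 1)) (Fin (n + 1)) R :=
  Matrix.of fun i j =>
    if i.val = j.val + 1 then d (j.val + 1)
    else if j.val = n then -(c (i.val + 1))
    else 0

open Polynomial in
/-- Laplace expansion along the first row of the characteristic matrix. -/
theorem charpoly_subdiagonalLastColumn_succ {R : Type*} [CommRing R] (n : ℕ) (c d : ℕ → R) :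
    (subdiagonalLastColumn (n + 1) c d).charpoly =
      X * (subdiagonalLastColumn n (fun i => c (i + 1)) (fun i => d (i + 1))).charpoly +
        C (c 1 * ∏ i ∈ Finset.Ico 1 (n + 2), d i) := by
  rw [Matrix.charpoly, Matrix.det_succ_row_zero, Fin.sum_univ_succ, Fin.sum_univ_castSucc,
    Finset.sum_eq_zero]
  · have h₁ : ((subdiagonalLastColumn (n + 1) c d).charmatrix.submatrix Fin.succ
        (Fin.succAbove 0)) =
        (subdiagonalLastColumn n (fun i => c (i + 1)) (fun i => d (i + 1))).charmatrix := by
      ext1 i j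
      simp [subdiagonalLastColumn, Matrix.charmatrix_apply, Matrix.diagonal_apply]
    have h₂ : ((subdiagonalLastColumn (n + 1) c d).charmatrix.submatrix Fin.succ
        (Fin.succAbove (Fin.last (n + 1)))).det =
        (-1) ^ (n + 1) * C (∏ i ∈ Finset.Ico 1 (n + 2), d i) := by
      rw [Matrix.det_of_isUpperTriangular]
      · have h : ∀ i : Fin (n + 1), (subdiagonalLastColumn (n + 1) c d).charmatrix.submatrix
            Fin.succ (Fin.succAbove (Fin.last (n + 1))) i i = -C (d (i + 1)) := by
          intro i
          have : i.succ ≠ i.castSucc := by simp [Fin.ext_iff]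
          simp [subdiagonalLastColumn, this]
        rw [Finset.prod_congr rfl fun i _ => h i, Finset.prod_neg, Finset.prod_Ico_eq_prod_range,
          map_prod]
        simp [Finset.prod_range, add_comm]
      · intro i j hij
        have hij' : (j : ℕ) < i := hij
        have h₁ : i.succ ≠ j.castSucc := by simp [Fin.ext_iff]; omega
        have h₂ : (i : ℕ) ≠ j := by omega
        have h₃ : (j : ℕ) ≠ n + 1 := by omega
        simp [subdiagonalLastColumn, h₁, h₂, h₃]
    have h₃ : (subdiagonalLastColumn (n + 1) c d).charmatrix 0 0 = X := by
      simp [subdiagonalLastColumn]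
    have h₄ : (subdiagonalLastColumn (n + 1) c d).charmatrix 0 (Fin.last (n + 1)) = C (c 1) := by
      have : (0 : Fin (n + 2)) ≠ Fin.last (n + 1) := by simp [Fin.ext_iff]
      simp [subdiagonalLastColumn, this]
    have h₅ : ((-1 : R[X]) ^ (n + 1)) * (-1) ^ (n + 1) = 1 := by
      rw [← mul_pow]; simp
    rw [h₁, Fin.succ_last, h₂, h₃, h₄, C_mul, Matrix.charpoly]
    simp only [Fin.val_zero, pow_zero, Fin.val_last, Nat.succ_eq_add_one]
    linear_combination C (c 1) * C (∏ i ∈ Finset.Ico 1 (n + 2), d i) * h₅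
  · intro j _
    have h₁ : (0 : Fin (n + 2)) ≠ j.castSucc.succ := (Fin.succ_ne_zero _).symm
    have h₂ : (j : ℕ) ≠ n := by omega
    simp [subdiagonalLastColumn, h₁, h₂]

theorem coeff_charpoly_subdiagonalLastColumn {R : Type*} [CommRing R] (n : ℕ) (c d : ℕ → R)
    (k : ℕ) (hk : k ≤ n) :
    (subdiagonalLastColumn n c d).charpoly.coeff k =
      c (k + 1) * ∏ i ∈ Finset.Ico (k + 1) (n + 1), d i := by
  induction n generalizing c d k with
  | zero =>
    obtain rfl : k = 0 := by omega
    simp [Matrix.charpoly, subdiagonalLastColumn]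
  | succ n ih =>
    rw [charpoly_subdiagonalLastColumn_succ]
    cases k with
    | zero => simp [-map_prod]
    | succ k =>
      rw [Polynomial.coeff_add, Polynomial.coeff_X_mul, Polynomial.coeff_C_succ, add_zero,
        ih _ _ k (by omega), Finset.prod_Ico_add']


/-- Let `A` be the `m×m` real matrix whose only nonzero entries are the
subdiagonal entries `A_{i+1,i} = d_i` (for `1 ≤ i ≤ m-1`) and the last-column
entries `A_{i,m} = -c_i` (for `1 ≤ i ≤ m`), where `d_1 > ⋯ > d_{m-1} > 0` and
`0 < c_1 < ⋯ < c_m < 1`. If `c_i d_i < c_{i+1}` for all `i ≤ m-1`, then the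
characteristic polynomial `det(λI - A) = Σ a_k λ^k` has strictly decreasing
positive coefficients `1 = a_m > a_{m-1} > ⋯ > a_0 > 0`, with
`a_0 = c_1 d_1 ⋯ d_{m-1}`. -/
theorem charpoly_coeffs_decreasing (m : ℕ) (hm : 1 ≤ m) (c d : ℕ → ℝ)
    (hd_pos : ∀ i, 1 ≤ i → i ≤ m - 1 → 0 < d i)
    (hd_dec : ∀ i, 1 ≤ i → i + 1 ≤ m - 1 → d (i + 1) < d i)
    (hc_pos : 0 < c 1) (hc_lt_one : c m < 1)
    (hc_inc : ∀ i, 1 ≤ i → i < m → c i < c (i + 1))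
    (hcd : ∀ i, 1 ≤ i → i ≤ m - 1 → c i * d i < c (i + 1))
    (A : Matrix (Fin m) (Fin m) ℝ)
    (hA : ∀ i j : Fin m, A i j =
      if i.val = j.val + 1 then d (j.val + 1)
      else if j.val = m - 1 then -(c (i.val + 1))
      else 0) :
    A.charpoly.coeff m = 1 ∧
    (∀ k, k < m → A.charpoly.coeff k < A.charpoly.coeff (k + 1)) ∧
    0 < A.charpoly.coeff 0 ∧
    A.charpoly.coeff 0 = c 1 * ∏ i ∈ Finset.Icc 1 (m - 1), d i := by
  obtain ⟨n, rfl⟩ : ∃ n, m = n + 1 := ⟨m - 1, by omega⟩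
  simp only [Nat.add_sub_cancel] at *
  obtain rfl : A = subdiagonalLastColumn n c d := by
    ext i j
    simp [hA, subdiagonalLastColumn]
  have htop : (subdiagonalLastColumn n c d).charpoly.coeff (n + 1) = 1 := by
    simpa using (Matrix.charpoly_monic (subdiagonalLastColumn n c d)).coeff_natDegree
  have hprod : ∀ k, 0 < ∏ i ∈ Finset.Ico (k + 1) (n + 1), d i := fun k =>
    Finset.prod_pos fun i hi => by
      rw [Finset.mem_Ico] at hi
      exact hd_pos i (by omega) (by omega)
  have hzero := coeff_charpoly_subdiagonalLastColumn n c d 0 (Nat.zero_le n)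
  refine ⟨htop, fun k hk => ?_, ?_, ?_⟩
  · rw [coeff_charpoly_subdiagonalLastColumn n c d k (by omega)]
    rcases Nat.lt_or_ge k n with hkn | hkn
    · rw [coeff_charpoly_subdiagonalLastColumn n c d (k + 1) (by omega),
        Finset.prod_eq_prod_Ico_succ_bot (by omega), ← mul_assoc]
      exact mul_lt_mul_of_pos_right (hcd (k + 1) (by omega) (by omega)) (hprod (k + 1))
    · obtain rfl : k = n := by omega
      simpa [htop] using hc_lt_one
  · rw [hzero]
    exact mul_pos hc_pos (hprod 0)
  · rw [hzero]
    congr 1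
end

section
/- Let θ ∈ (2/3, 1), n ≥ 2, and for c ∈ (0, 1/(2θ)] define g_c(x) = x(1−θx)/(c(1−θc)). Suppose the sufficient condition g_{1/(2θ)}^{n−1}(1/θ − 1) ≤ 1/(2θ) holds (where g_{1/(2θ)}^{n−1} is the (n−1)-st iterate). Then there exists c ∈ (0, 1/(2θ)] such that g_c^{n−1}(1/θ − 1) = c; that is, the cyclic-periodicity equation for a period-n point of the Dikin process on n coordinates has a solution. -/
/-- For `θ ∈ (2/3, 1)`, `n ≥ 2`, and `g_c(x) = x(1-θx)/(c(1-θc))`: if the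
sufficient condition `g_{1/(2θ)}^{n-1}(1/θ - 1) ≤ 1/(2θ)` holds, then there is
`c ∈ (0, 1/(2θ)]` with `g_c^{n-1}(1/θ - 1) = c`, i.e. the cyclic-periodicity
equation for a period-`n` point of the Dikin process has a solution. -/
theorem cyclic_periodicity_solution (θ : ℝ) (hθ0 : 2 / 3 < θ) (hθ1 : θ < 1)
    (n : ℕ) (hn : 2 ≤ n)
    (g : ℝ → ℝ → ℝ) (hg : ∀ c x, g c x = x * (1 - θ * x) / (c * (1 - θ * c)))
    (hcond : (g (1 / (2 * θ)))^[n - 1] (1 / θ - 1) ≤ 1 / (2 * θ)) :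
    ∃ c ∈ Set.Ioc (0 : ℝ) (1 / (2 * θ)), (g c)^[n - 1] (1 / θ - 1) = c := by
  have hθ : 0 < θ := by linarith
  have hinv : θ * (1 / θ) = 1 := by field_simp
  have hinv2 : θ * (1 / (2 * θ)) = 1 / 2 := by field_simp
  have ha : 0 < 1 / θ - 1 := by nlinarith
  have ha1 : 1 / θ - 1 < 1 := by nlinarith
  have hab : 1 / θ - 1 ≤ 1 / (2 * θ) := by nlinarith
  have hden : ∀ c ∈ Set.Icc (1 / θ - 1) (1 / (2 * θ)), c * (1 - θ * c) ≠ 0 := by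
    rintro c ⟨h1, h2⟩
    have hc : 0 < c := by linarith
    have : θ * c ≤ 1 / 2 := hinv2 ▸ mul_le_mul_of_nonneg_left h2 hθ.le
    have : 0 < 1 - θ * c := by linarith
    positivity
  have hval : (1 / θ - 1) * (1 - θ * (1 / θ - 1)) = 1 - θ := by
    field_simp
    ring
  have hcont : ∀ k : ℕ, ContinuousOn (fun c => (g c)^[k] (1 / θ - 1))
      (Set.Icc (1 / θ - 1) (1 / (2 * θ))) := by
    intro k
    induction k with
    | zero => exact continuousOn_const
    | succ k ih =>
      simp only [Function.iterate_succ_apply', hg]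
      exact (ih.mul (continuousOn_const.sub (continuousOn_const.mul ih))).div
        (by fun_prop) hden
  have hfix : ∀ k : ℕ, (g (1 / θ - 1))^[k + 1] (1 / θ - 1) = 1 := by
    have h1θ : 1 - θ ≠ 0 := by linarith
    intro k
    induction k with
    | zero => simp only [zero_add, Function.iterate_one, hg, hval, div_self h1θ]
    | succ k ih =>
      rw [Function.iterate_succ_apply', ih, hg, hval, mul_one, one_mul, div_self h1θ]
  obtain ⟨m, rfl⟩ : ∃ m, n = m + 2 := ⟨n - 2, by omega⟩
  obtain ⟨c, hc, hc0⟩ := intermediate_value_Icc' hab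
    ((hcont (m + 2 - 1)).sub continuousOn_id)
    (show (0 : ℝ) ∈ Set.Icc _ _ from
      ⟨sub_nonpos.2 hcond, sub_nonneg.2 (ha1.le.trans_eq (hfix m).symm)⟩)
  exact ⟨c, ⟨ha.trans_le hc.1, hc.2⟩, sub_eq_zero.1 hc0⟩
end

section
/- For every n ≥ 2 there exists θ₀ < 1 such that for all θ ∈ (θ₀, 1), the condition g^{n−1}(1/θ − 1) ≤ 1/(2θ) holds, where g(x) = 4θx(1−θx) and g^{n−1} denotes the (n−1)-st iterate; consequently the sufficient condition for existence of a period-n cyclic point of the Dikin process on n coordinates is satisfied for all θ sufficiently close to 1. -/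
/-- Iterating `x ↦ 4θx(1-θx)` with `θ ∈ [0, 1]` grows a nonnegative point by at most a factor `4`
per step. -/
theorem iterate_logistic_le {θ x : ℝ} (h0 : 0 ≤ θ) (h1 : θ ≤ 1) (hx : 0 ≤ x) (k : ℕ) :
    (fun x : ℝ => 4 * θ * x * (1 - θ * x))^[k] x ≤ 4 ^ k * x := by
  induction k with
  | zero => simp
  | succ k ih =>
    rw [Function.iterate_succ_apply']
    set y := (fun x : ℝ => 4 * θ * x * (1 - θ * x))^[k] x
    have hc : 0 ≤ 4 ^ k * x := by positivity
    calc 4 * θ * y * (1 - θ * y) ≤ 4 * (θ * y) := by nlinarith [sq_nonneg (θ * y)]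
      _ ≤ 4 * (θ * (4 ^ k * x)) := by gcongr
      _ ≤ 4 * (4 ^ k * x) :=
        mul_le_mul_of_nonneg_left (mul_le_of_le_one_left hc h1) (by norm_num)
      _ = 4 ^ (k + 1) * x := by ring


/-- For every `n ≥ 2` there is `θ₀ < 1` such that for all `θ ∈ (θ₀, 1)` the
condition `g^{n-1}(1/θ - 1) ≤ 1/(2θ)` holds for `g(x) = 4θx(1-θx)`; hence the
sufficient condition for a period-`n` cyclic point of the Dikin process on `n`
coordinates is satisfied for all `θ` sufficiently close to `1`. -/
theorem condition_holds_near_one (n : ℕ) (hn : 2 ≤ n) :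
    ∃ θ₀ : ℝ, θ₀ < 1 ∧ ∀ θ : ℝ, θ₀ < θ → θ < 1 →
      (fun x : ℝ => 4 * θ * x * (1 - θ * x))^[n - 1] (1 / θ - 1) ≤ 1 / (2 * θ) := by
  have hC : (1 : ℝ) ≤ 4 ^ (n - 1) := one_le_pow₀ (by norm_num)
  refine ⟨1 - 1 / (2 * 4 ^ (n - 1)), sub_lt_self _ (by positivity), fun θ hθ hθ1 => ?_⟩
  have hmul : 4 ^ (n - 1) * (1 - θ) < 1 / 2 := by
    rw [sub_lt_comm, lt_div_iff₀ (by positivity)] at hθ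
    linarith
  have hpos : 0 < θ := by nlinarith
  have hx : 1 / θ - 1 = (1 - θ) / θ := by field_simp
  have hx0 : 0 ≤ 1 / θ - 1 := hx ▸ div_nonneg (by linarith) hpos.le
  calc _ ≤ 4 ^ (n - 1) * (1 / θ - 1) := iterate_logistic_le hpos.le hθ1.le hx0 _
    _ = 4 ^ (n - 1) * (1 - θ) / θ := by rw [hx, mul_div_assoc]
    _ ≤ 1 / 2 / θ := by gcongr
    _ = 1 / (2 * θ) := by rw [div_div]
end
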